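/- The sequence (aₙ² + bₙ² + ∑_{k=1}^{n−1}(aₙd₂ₖ − bₙd₁ₖ)²)/det(I₂ + Dₙ₋₁ᵀDₙ₋₁) converges, as n → ∞, to (γ² − 1)³(ℓ′)²/(γ⁴ℓ⁴) + 2(γ² − 1)²ℓ′/(γℓ³) + (γ⁴ − 1)/ℓ². -/

import Mathlib

open Matrix Filter

/-- The partial sum `∑_{p=1}^{m} p^j r^p`. -/
noncomputable def powGeomSum (r : ℝ) (j m : ℕ) : ℝ :=
  ∑ i ∈ Finset.range m, ((i : ℝ) + 1) ^ j * r ^ (i + 1)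

lemma sum_affine_mul_affine_mul_geom (r x y x' y' K : ℝ) (m : ℕ) :
    ∑ i ∈ Finset.range m,
        K * ((x + ((i : ℝ) + 1) * y) * (x' + ((i : ℝ) + 1) * y') * r ^ (i + 1)) =
      K * (x * x' * powGeomSum r 0 m + (x * y' + y * x') * powGeomSum r 1 m
        + y * y' * powGeomSum r 2 m) := by
  simp only [powGeomSum, Finset.mul_sum, ← Finset.sum_add_distrib]
  exact Finset.sum_congr rfl fun i _ => by ring

lemma tendsto_powGeomSum_zero {r : ℝ} (hr : |r| < 1) :
    Tendsto (powGeomSum r 0) atTop (nhds (r / (1 - r))) := by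
  have h := ((hasSum_geometric_of_abs_lt_one hr).mul_left r).tendsto_sum_nat
  rw [div_eq_mul_inv]
  refine h.congr fun m => Finset.sum_congr rfl fun i _ => by ring

lemma tendsto_powGeomSum_one {r : ℝ} (hr : |r| < 1) :
    Tendsto (powGeomSum r 1) atTop (nhds (r / (1 - r) ^ 2)) := by
  have h := ((hasSum_choose_mul_geometric_of_norm_lt_one 1 hr).mul_left r).tendsto_sum_nat
  rw [show r / (1 - r) ^ 2 = r * (1 / (1 - r) ^ (1 + 1)) by ring]
  refine h.congr fun m => Finset.sum_congr rfl fun i _ => ?_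
  rw [Nat.choose_one_right]
  push_cast
  ring

lemma tendsto_powGeomSum_two {r : ℝ} (hr : |r| < 1) :
    Tendsto (powGeomSum r 2) atTop (nhds (r * (1 + r) / (1 - r) ^ 3)) := by
  have h := (((hasSum_choose_mul_geometric_of_norm_lt_one 2 hr).mul_left (2 * r)).sub
    ((hasSum_choose_mul_geometric_of_norm_lt_one 1 hr).mul_left r)).tendsto_sum_nat
  have hr1 : 1 - r ≠ 0 := by linarith [(abs_lt.mp hr).2]
  rw [show r * (1 + r) / (1 - r) ^ 3 =
    2 * r * (1 / (1 - r) ^ (2 + 1)) - r * (1 / (1 - r) ^ (1 + 1)) by field_simp; ring]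
  refine h.congr fun m => Finset.sum_congr rfl fun i _ => ?_
  rw [Nat.choose_one_right, Nat.cast_choose_two]
  push_cast
  ring

lemma det_one_add_transpose_mul_self_two {m : ℕ} (u v : ℕ → ℝ) :
    ((1 : Matrix (Fin 2) (Fin 2) ℝ) +
        (Matrix.of fun (k : Fin m) i => ![u (k.val + 1), v (k.val + 1)] i)ᵀ *
          (Matrix.of fun (k : Fin m) i => ![u (k.val + 1), v (k.val + 1)] i)).det =
      (1 + ∑ k ∈ Finset.range m, u (k + 1) * u (k + 1)) *
          (1 + ∑ k ∈ Finset.range m, v (k + 1) * v (k + 1)) -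
        (∑ k ∈ Finset.range m, u (k + 1) * v (k + 1)) ^ 2 := by
  simp only [Matrix.det_fin_two, Matrix.add_apply, Matrix.mul_apply, Matrix.transpose_apply,
    Matrix.of_apply, Matrix.one_apply_eq, Matrix.cons_val_zero, Matrix.cons_val_one,
    Fin.sum_univ_eq_sum_range (fun k => u (k + 1) * u (k + 1)) m,
    Fin.sum_univ_eq_sum_range (fun k => v (k + 1) * v (k + 1)) m,
    Fin.sum_univ_eq_sum_range (fun k => u (k + 1) * v (k + 1)) m,
    Matrix.one_apply_ne (zero_ne_one' (Fin 2)), Matrix.one_apply_ne (one_ne_zero' (Fin 2)),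
    mul_comm (v _) (u _)]
  ring

lemma sum_range_succ_eq_sum_reflect (F : ℕ → ℝ) (m : ℕ) :
    ∑ k ∈ Finset.range m, F (k + 1) = ∑ i ∈ Finset.range m, F (m - i) := by
  rw [← Finset.sum_range_reflect]
  refine Finset.sum_congr rfl fun i hi => ?_
  have := Finset.mem_range.mp hi
  congr 1
  omega

lemma zpow_sub_sub_one {γ : ℝ} (hγ : γ ≠ 0) {m i : ℕ} (hi : i < m) :
    γ ^ (((m - i : ℕ) : ℤ) - 1) = γ ^ m * γ⁻¹ ^ (i + 1) := by
  rw [show ((m - i : ℕ) : ℤ) - 1 = (m : ℤ) - ((i + 1 : ℕ) : ℤ) by omega, zpow_sub₀ hγ,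
    zpow_natCast, zpow_natCast, inv_pow, div_eq_mul_inv]

lemma zpow_sub_sub_two {γ : ℝ} (hγ : γ ≠ 0) {m i : ℕ} (hi : i < m) :
    γ ^ (((m - i : ℕ) : ℤ) - 2) = γ ^ m * γ⁻¹ ^ (i + 1) * γ⁻¹ := by
  rw [← zpow_sub_sub_one hγ hi, ← zpow_sub_one₀ hγ]
  congr 1
  ring

/-- limiting power usage of the SK(2) scheme in Case B
(eq. (39)): the sequence converges to
`(γ²−1)³(ℓ′)²/(γ⁴ℓ⁴) + 2(γ²−1)²ℓ′/(γℓ³) + (γ⁴−1)/ℓ²`. -/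
theorem stmt11 (γ ℓ ℓ' : ℝ) (hγ : 1 < |γ|) (hl : ℓ ≠ 0) :
    let d₁ : ℕ → ℝ := fun k =>
      ((2 - (k : ℝ)) * ℓ + ℓ' * γ⁻¹) * γ ^ ((k : ℤ) - 1)
    let d₂ : ℕ → ℝ := fun k =>
      (((k : ℝ) - 1) * ℓ - ℓ' * γ⁻¹) * γ ^ ((k : ℤ) - 2)
    let a : ℕ → ℝ := fun k => (2 - (k : ℝ)) * γ ^ ((k : ℤ) - 1)
    let b : ℕ → ℝ := fun k => ((k : ℝ) - 1) * γ ^ ((k : ℤ) - 2)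
    let Dm : (n : ℕ) → Matrix (Fin n) (Fin 2) ℝ := fun n =>
      Matrix.of fun k i => ![d₁ (k.val + 1), d₂ (k.val + 1)] i
    Tendsto (fun n : ℕ =>
        (a n ^ 2 + b n ^ 2 +
            ∑ k ∈ Finset.Icc 1 (n - 1), (a n * d₂ k - b n * d₁ k) ^ 2) /
          ((1 : Matrix (Fin 2) (Fin 2) ℝ) + (Dm (n - 1))ᵀ * Dm (n - 1)).det)
      atTop
      (nhds ((γ ^ 2 - 1) ^ 3 * ℓ' ^ 2 / (γ ^ 4 * ℓ ^ 4)
        + 2 * (γ ^ 2 - 1) ^ 2 * ℓ' / (γ * ℓ ^ 3)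
        + (γ ^ 4 - 1) / ℓ ^ 2)) := by
  intro d₁ d₂ a b Dm
  have hγ0 : γ ≠ 0 := by rintro rfl; norm_num at hγ
  have hsq : 1 < γ ^ 2 := by rw [← sq_abs]; nlinarith
  set c := ℓ' * γ⁻¹ with hc
  set r := γ⁻¹ ^ 2 with hr
  have hr_pos : 0 < r := by positivity
  have hr_lt : r < 1 := by rw [hr, inv_pow]; exact inv_lt_one_of_one_lt₀ hsq
  have hr_abs : |r| < 1 := by rwa [abs_of_pos hr_pos]
  have hpow (i : ℕ) : γ⁻¹ ^ i * γ⁻¹ ^ i = r ^ i := by rw [hr, ← mul_pow, ← sq]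
  have hd₁ {m i : ℕ} (hi : i < m) : d₁ (m - i) =
      (((1 - (m : ℝ)) * ℓ + c) + ((i : ℝ) + 1) * ℓ) * (γ ^ m * γ⁻¹ ^ (i + 1)) := by
    simp only [d₁]
    rw [zpow_sub_sub_one hγ0 hi, Nat.cast_sub hi.le]
    ring
  have hd₂ {m i : ℕ} (hi : i < m) : d₂ (m - i) =
      ((m * ℓ - c) + ((i : ℝ) + 1) * (-ℓ)) * (γ ^ m * γ⁻¹ ^ (i + 1) * γ⁻¹) := by
    simp only [d₂]
    rw [zpow_sub_sub_two hγ0 hi, Nat.cast_sub hi.le]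
    ring
  have ha (m : ℕ) : a (m + 1) = (1 - (m : ℝ)) * γ ^ m := by
    simp only [a]
    push_cast
    rw [add_sub_cancel_right, zpow_natCast]
    ring
  have hb (m : ℕ) : b (m + 1) = m * (γ ^ m * γ⁻¹) := by
    simp only [b]
    push_cast
    rw [show (m : ℤ) + 1 - 2 = m - 1 by ring, zpow_sub_one₀ hγ0, zpow_natCast]
    ring
  have h11 (m : ℕ) : ∑ k ∈ Finset.range m, d₁ (k + 1) * d₁ (k + 1) =
      (γ ^ m) ^ 2 * (((1 - (m : ℝ)) * ℓ + c) * ((1 - (m : ℝ)) * ℓ + c) * powGeomSum r 0 m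
        + (((1 - (m : ℝ)) * ℓ + c) * ℓ + ℓ * ((1 - (m : ℝ)) * ℓ + c)) * powGeomSum r 1 m
        + ℓ * ℓ * powGeomSum r 2 m) := by
    rw [sum_range_succ_eq_sum_reflect (fun k => d₁ k * d₁ k),
      ← sum_affine_mul_affine_mul_geom]
    refine Finset.sum_congr rfl fun i hi => ?_
    rw [hd₁ (Finset.mem_range.mp hi), ← hpow]
    ring
  have h22 (m : ℕ) : ∑ k ∈ Finset.range m, d₂ (k + 1) * d₂ (k + 1) =
      ((γ ^ m) ^ 2 * γ⁻¹ ^ 2) * ((m * ℓ - c) * (m * ℓ - c) * powGeomSum r 0 m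
        + ((m * ℓ - c) * (-ℓ) + (-ℓ) * (m * ℓ - c)) * powGeomSum r 1 m
        + (-ℓ) * (-ℓ) * powGeomSum r 2 m) := by
    rw [sum_range_succ_eq_sum_reflect (fun k => d₂ k * d₂ k),
      ← sum_affine_mul_affine_mul_geom]
    refine Finset.sum_congr rfl fun i hi => ?_
    rw [hd₂ (Finset.mem_range.mp hi), ← hpow]
    ring
  have h12 (m : ℕ) : ∑ k ∈ Finset.range m, d₁ (k + 1) * d₂ (k + 1) =
      ((γ ^ m) ^ 2 * γ⁻¹) * (((1 - (m : ℝ)) * ℓ + c) * (m * ℓ - c) * powGeomSum r 0 m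
        + (((1 - (m : ℝ)) * ℓ + c) * (-ℓ) + ℓ * (m * ℓ - c)) * powGeomSum r 1 m
        + ℓ * (-ℓ) * powGeomSum r 2 m) := by
    rw [sum_range_succ_eq_sum_reflect (fun k => d₁ k * d₂ k),
      ← sum_affine_mul_affine_mul_geom]
    refine Finset.sum_congr rfl fun i hi => ?_
    rw [hd₁ (Finset.mem_range.mp hi), hd₂ (Finset.mem_range.mp hi), ← hpow]
    ring
  have hnum (m : ℕ) :
      ∑ k ∈ Finset.Icc 1 m, (a (m + 1) * d₂ k - b (m + 1) * d₁ k) ^ 2 =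
      ((γ ^ m) ^ 4 * γ⁻¹ ^ 2) * (c * c * powGeomSum r 0 m
        + (c * ℓ + ℓ * c) * powGeomSum r 1 m
        + ℓ * ℓ * powGeomSum r 2 m) := by
    rw [← Finset.Ico_add_one_right_eq_Icc, Finset.sum_Ico_eq_sum_range, Nat.add_sub_cancel]
    simp only [add_comm 1]
    rw [sum_range_succ_eq_sum_reflect (fun k => (a (m + 1) * d₂ k - b (m + 1) * d₁ k) ^ 2),
      ← sum_affine_mul_affine_mul_geom]
    refine Finset.sum_congr rfl fun i hi => ?_
    rw [hd₁ (Finset.mem_range.mp hi), hd₂ (Finset.mem_range.mp hi), ha, hb, ← hpow]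
    ring
  rw [← tendsto_add_atTop_iff_nat 1]
  simp only [Nat.add_sub_cancel]
  have h0 : Tendsto (fun m : ℕ => r ^ m) atTop (nhds 0) :=
    tendsto_pow_atTop_nhds_zero_of_abs_lt_one hr_abs
  have h1 : Tendsto (fun m : ℕ => (m : ℝ) * r ^ m) atTop (nhds 0) :=
    tendsto_self_mul_const_pow_of_abs_lt_one hr_abs
  have h2 : Tendsto (fun m : ℕ => (m : ℝ) ^ 2 * r ^ m) atTop (nhds 0) :=
    tendsto_pow_const_mul_const_pow_of_abs_lt_one 2 hr_abs
  have hA0 := tendsto_powGeomSum_zero hr_abs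
  have hA1 := tendsto_powGeomSum_one hr_abs
  have hA2 := tendsto_powGeomSum_two hr_abs
  have hN := ((((h0.sub (h1.const_mul 2)).add h2).const_mul (γ ^ 2)).add h2).add
    (((hA0.const_mul (c ^ 2)).add (hA1.const_mul (2 * c * ℓ))).add (hA2.const_mul (ℓ ^ 2)))
  have hx1 := (h0.const_mul (ℓ + c)).sub (h1.const_mul ℓ)
  have hx2 := ((h0.const_mul ((ℓ + c) ^ 2)).sub (h1.const_mul (2 * (ℓ + c) * ℓ))).add
    (h2.const_mul (ℓ ^ 2))
  have hw1 := (h1.const_mul ℓ).sub (h0.const_mul c)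
  have hw2 := ((h2.const_mul (ℓ ^ 2)).sub (h1.const_mul (2 * ℓ * c))).add
    (h0.const_mul (c ^ 2))
  have hQ1 := ((hx2.mul hA0).add ((hx1.mul hA1).const_mul (2 * ℓ))).add
    ((h0.mul hA2).const_mul (ℓ ^ 2))
  have hQ2 := ((hw2.mul hA0).sub ((hw1.mul hA1).const_mul (2 * ℓ))).add
    ((h0.mul hA2).const_mul (ℓ ^ 2))
  have hD := ((((h0.pow 2).const_mul (γ ^ 2)).add (hQ1.const_mul (γ ^ 2))).add hQ2).add
    (((hA0.mul hA2).sub (hA1.pow 2)).const_mul (ℓ ^ 4))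
  have h1r : 1 - r ≠ 0 := by linarith
  have hdet : r / (1 - r) * (r * (1 + r) / (1 - r) ^ 3) - (r / (1 - r) ^ 2) ^ 2 =
      r ^ 3 / (1 - r) ^ 4 := by
    field_simp
    ring
  rw [hdet] at hD
  have hlim := hN.div hD (by simp [hl, hr_pos.ne', h1r])
  refine (hlim.congr fun m => ?_).mono_right (congrArg nhds ?_).le
  · rw [det_one_add_transpose_mul_self_two, Nat.add_sub_cancel, h11, h22, h12, hnum, ha, hb]
    have hg : γ ^ m ≠ 0 := pow_ne_zero m hγ0
    have hrm : r ^ m = 1 / (γ ^ m) ^ 2 := by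
      rw [hr, ← pow_mul, mul_comm, pow_mul, inv_pow, inv_pow, one_div]
    simp only [Pi.div_apply, hrm]
    rw [← mul_div_mul_left _ _ (show (γ ^ m) ^ 4 * γ⁻¹ ^ 2 ≠ 0 by positivity)]
    clear_value c
    congr 1 <;> (field_simp; ring)
  · have hcγ : c = ℓ' / γ := div_eq_mul_inv _ _ |>.symm
    have hrγ : r = 1 / γ ^ 2 := by rw [hr, inv_pow, one_div]
    have h1γ : 1 - r = (γ ^ 2 - 1) / γ ^ 2 := by rw [hrγ]; field_simp
    have hγ1 : γ ^ 2 - 1 ≠ 0 := by linarith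
    rw [h1γ, hcγ, hrγ]
    simp only [mul_zero, zero_mul, add_zero, sub_zero, zero_add, ne_eq, OfNat.ofNat_ne_zero,
      not_false_eq_true, zero_pow]
    field_simp
    ring
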